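/- The series ∑_{k=1}^∞ H_k·h_k²/k² converges and equals (155/32)·ζ(5) + (7/8)·ζ(2)·ζ(3). -/

import Mathlib

open Finset Real

noncomputable def H (k : ℕ) : ℝ := ∑ j ∈ Finset.range k, (1 : ℝ) / ((j : ℝ) + 1)
noncomputable def H2 (k : ℕ) : ℝ := ∑ j ∈ Finset.range k, (1 : ℝ) / ((j : ℝ) + 1) ^ 2
noncomputable def H3 (k : ℕ) : ℝ := ∑ j ∈ Finset.range k, (1 : ℝ) / ((j : ℝ) + 1) ^ 3
noncomputable def h (k : ℕ) : ℝ := ∑ j ∈ Finset.range k, (1 : ℝ) / (2 * (j : ℝ) + 1)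
noncomputable def h2 (k : ℕ) : ℝ := ∑ j ∈ Finset.range k, (1 : ℝ) / (2 * (j : ℝ) + 1) ^ 2
noncomputable def h3 (k : ℕ) : ℝ := ∑ j ∈ Finset.range k, (1 : ℝ) / (2 * (j : ℝ) + 1) ^ 3
noncomputable def zeta (s : ℕ) : ℝ := ∑' n : ℕ, (1 : ℝ) / ((n : ℝ) + 1) ^ s

lemma hasSum_of_eq {f g : ℕ → ℝ} {a b : ℝ} (hf : HasSum f a) (hfg : ∀ n, g n = f n)
    (hab : b = a) : HasSum g b := by
  rw [hab, funext hfg]; exact hf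

/-- The sum of `1 / m ^ s` over the odd positive integers `m`. -/
noncomputable def oddZeta (s : ℕ) : ℝ := ∑' m : ℕ, (1 : ℝ) / (2 * (m : ℝ) + 1) ^ s

lemma hasSum_zeta {s : ℕ} (hs : 1 < s) :
    HasSum (fun n : ℕ => (1 : ℝ) / ((n : ℝ) + 1) ^ s) (zeta s) := by
  have := (summable_nat_add_iff 1).2 (Real.summable_one_div_nat_pow.2 hs)
  simp only [Nat.cast_add, Nat.cast_one] at this
  exact this.hasSum

lemma hasSum_oddZeta {s : ℕ} (hs : 1 < s) :
    HasSum (fun m : ℕ => (1 : ℝ) / (2 * (m : ℝ) + 1) ^ s) (oddZeta s) := by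
  have h1 := (hasSum_zeta hs).summable.comp_injective
    (mul_right_injective₀ (two_ne_zero' ℕ))
  refine Summable.hasSum (h1.congr fun m => ?_)
  simp

lemma oddZeta_eq {s : ℕ} (hs : 1 < s) : oddZeta s = (1 - 1 / 2 ^ s) * zeta s := by
  have h1 := (hasSum_zeta hs).mul_left ((1 : ℝ) / 2 ^ s)
  have h2 : HasSum (fun n : ℕ => (1 : ℝ) / ((n : ℝ) + 1) ^ s)
      (oddZeta s + 1 / 2 ^ s * zeta s) := by
    refine HasSum.even_add_odd ?_ ?_
    · simpa using hasSum_oddZeta hs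
    · refine hasSum_of_eq h1 (fun m => ?_) rfl
      rw [one_div_mul_one_div, ← mul_pow]
      push_cast
      ring
  have := h2.unique (hasSum_zeta hs)
  linarith

lemma one_le_abs_even_sub_odd (k m : ℕ) :
    1 ≤ |(2 * ((k : ℝ) + 1)) - (2 * (m : ℝ) + 1)| := by
  have : (1 : ℤ) ≤ |(2 * ((k : ℤ) + 1)) - (2 * (m : ℤ) + 1)| := by
    apply Int.one_le_abs; omega
  exact_mod_cast this

lemma even_sub_odd_ne_zero (k m : ℕ) : (2 * ((k : ℝ) + 1)) - (2 * (m : ℝ) + 1) ≠ 0 := by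
  intro h0
  have := one_le_abs_even_sub_odd k m
  rw [h0] at this
  norm_num at this

lemma hasSum_sq_odd_sub (k : ℕ) :
    HasSum (fun m : ℕ => (1 : ℝ) / (2 * (m : ℝ) + 1 - 2 * k) ^ 2) (oddZeta 2 + h2 k) := by
  induction k with
  | zero => simpa [h2] using hasSum_oddZeta (s := 2) one_lt_two
  | succ k ih =>
    have := (hasSum_nat_add_iff (f := fun m : ℕ =>
      (1 : ℝ) / (2 * (m : ℝ) + 1 - 2 * (k + 1 : ℕ)) ^ 2) 1 (g := oddZeta 2 + h2 k)).1 (by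
        refine hasSum_of_eq ih (fun m => ?_) rfl
        push_cast
        ring_nf)
    refine hasSum_of_eq this (fun _ => rfl) ?_
    simp only [h2, Finset.sum_range_succ, Finset.sum_range_zero]
    have : (2 * (k : ℝ) + 1) ≠ 0 := by positivity
    push_cast
    rw [show (2 * (0 : ℝ) + 1 - 2 * (k + 1)) ^ 2 = (2 * k + 1) ^ 2 by ring]
    ring

lemma hasSum_sq_odd_add (k : ℕ) :
    HasSum (fun m : ℕ => (1 : ℝ) / (2 * (m : ℝ) + 1 + 2 * k) ^ 2) (oddZeta 2 - h2 k) := by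
  have := (hasSum_nat_add_iff' k).2 (hasSum_oddZeta (s := 2) one_lt_two)
  refine hasSum_of_eq this (fun m => ?_) rfl
  push_cast
  ring_nf

lemma tendsto_one_div_two_mul_add (c : ℝ) :
    Filter.Tendsto (fun n : ℕ => (1 : ℝ) / (2 * (n : ℝ) + c)) Filter.atTop (nhds 0) := by
  have h1 : Filter.Tendsto (fun n : ℕ => 2 * (n : ℝ) + c) Filter.atTop Filter.atTop :=
    Filter.tendsto_atTop_add_const_right _ _
      (tendsto_natCast_atTop_atTop.const_mul_atTop two_pos)
  simp only [one_div]
  exact h1.inv_tendsto_atTop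

lemma tendsto_sum_h (k : ℕ) :
    Filter.Tendsto (fun M => ∑ m ∈ Finset.range M, ((1 : ℝ) / (2 * (m : ℝ) + 1)
      - (1 / (2 * (m : ℝ) + 1 - 2 * k) + 1 / (2 * (m : ℝ) + 1 + 2 * k)) / 2))
      Filter.atTop (nhds (h k)) := by
  induction k with
  | zero => simp [h]
  | succ k ih =>
    have e : ∀ M, ∑ m ∈ Finset.range M, ((1 : ℝ) / (2 * (m : ℝ) + 1)
        - (1 / (2 * (m : ℝ) + 1 - 2 * (k + 1 : ℕ)) + 1 / (2 * (m : ℝ) + 1 + 2 * (k + 1 : ℕ))) / 2)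
        = ∑ m ∈ Finset.range M, ((1 : ℝ) / (2 * (m : ℝ) + 1)
          - (1 / (2 * (m : ℝ) + 1 - 2 * k) + 1 / (2 * (m : ℝ) + 1 + 2 * k)) / 2)
        + (1 / (2 * (M : ℝ) + (-2 * k - 1)) + 1 / (2 * k + 1)) / 2
        + (1 / (2 * k + 1) - 1 / (2 * (M : ℝ) + (1 + 2 * k))) / 2 := by
      intro M
      induction M with
      | zero =>
        have : (2 * (k : ℝ) + 1) ≠ 0 := by positivity
        have : (-(2 * (k : ℝ)) - 1) ≠ 0 := by
          rw [show (-(2 * (k : ℝ)) - 1) = -(2 * (k : ℝ) + 1) by ring]; exact neg_ne_zero.2 this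
        simp
        field_simp
        ring
      | succ M ihM =>
        rw [Finset.sum_range_succ, ihM, Finset.sum_range_succ]
        push_cast
        rw [show 2 * ((M : ℝ) + 1) + (-2 * k - 1) = 2 * M + 1 - 2 * k by ring,
          show 2 * ((M : ℝ) + 1) + (1 + 2 * k) = 2 * M + 1 + 2 * (k + 1) by ring,
          show 2 * (M : ℝ) + (-2 * k - 1) = 2 * M + 1 - 2 * (k + 1) by ring,
          show 2 * (M : ℝ) + (1 + 2 * k) = 2 * M + 1 + 2 * k by ring]
        ring
    simp only [e]
    have := (ih.add (((tendsto_one_div_two_mul_add (-2 * k - 1)).add_const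
      (1 / (2 * (k : ℝ) + 1))).div_const 2)).add
      (((tendsto_one_div_two_mul_add (1 + 2 * k)).const_sub (1 / (2 * (k : ℝ) + 1))).div_const 2)
    convert this using 2
    rw [h, Finset.sum_range_succ, ← h]
    ring

lemma tendsto_sum_inv_even_sq_sub (m : ℕ) :
    Filter.Tendsto (fun K => ∑ k ∈ Finset.range K, ((1 : ℝ) / (2 * (k : ℝ) + 1 - 2 * m)
      - 1 / (2 * (k : ℝ) + 1 + 2 * (m + 1 : ℕ)))) Filter.atTop (nhds (1 / (2 * m + 1))) := by
  induction m with
  | zero =>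
    have e : ∀ K, ∑ k ∈ Finset.range K, ((1 : ℝ) / (2 * (k : ℝ) + 1 - 2 * (0 : ℕ))
      - 1 / (2 * (k : ℝ) + 1 + 2 * (0 + 1 : ℕ))) = 1 - 1 / (2 * (K : ℝ) + 1) := by
      intro K
      have := Finset.sum_range_sub' (fun k : ℕ => (1 : ℝ) / (2 * (k : ℝ) + 1)) K
      simp only [Nat.cast_zero, mul_zero, zero_add, div_one] at this
      rw [← this]
      refine Finset.sum_congr rfl fun k _ => ?_
      push_cast
      congr 2 <;> ring
    simp only [e]
    simpa using (tendsto_one_div_two_mul_add 1).const_sub 1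
  | succ m ih =>
    have e : ∀ K, ∑ k ∈ Finset.range K, ((1 : ℝ) / (2 * (k : ℝ) + 1 - 2 * (m + 1 : ℕ))
        - 1 / (2 * (k : ℝ) + 1 + 2 * (m + 1 + 1 : ℕ)))
        = ∑ k ∈ Finset.range K, ((1 : ℝ) / (2 * (k : ℝ) + 1 - 2 * m)
          - 1 / (2 * (k : ℝ) + 1 + 2 * (m + 1 : ℕ)))
        + (-(1 / (2 * m + 1)) - 1 / (2 * (K : ℝ) + (-2 * m - 1)))
        + (1 / (2 * m + 3) - 1 / (2 * (K : ℝ) + (2 * m + 3))) := by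
      intro K
      induction K with
      | zero =>
        have : (2 * (m : ℝ) + 1) ≠ 0 := by positivity
        have : (-(2 * (m : ℝ)) - 1) ≠ 0 := by
          rw [show (-(2 * (m : ℝ)) - 1) = -(2 * (m : ℝ) + 1) by ring]; exact neg_ne_zero.2 this
        simp
        field_simp
        ring
      | succ K ihK =>
        rw [Finset.sum_range_succ, ihK, Finset.sum_range_succ]
        push_cast
        rw [show 2 * ((K : ℝ) + 1) + (-2 * m - 1) = 2 * K + 1 - 2 * m by ring,
          show 2 * ((K : ℝ) + 1) + (2 * m + 3) = 2 * K + 1 + 2 * (m + 1 + 1) by ring,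
          show 2 * (K : ℝ) + (-2 * m - 1) = 2 * K + 1 - 2 * (m + 1) by ring,
          show 2 * (K : ℝ) + (2 * m + 3) = 2 * K + 1 + 2 * (m + 1) by ring]
        ring
    simp only [e]
    have := (ih.add ((tendsto_one_div_two_mul_add (-2 * m - 1)).const_sub
      (-(1 / (2 * (m : ℝ) + 1))))).add
      ((tendsto_one_div_two_mul_add (2 * m + 3)).const_sub (1 / (2 * (m : ℝ) + 3)))
    convert this using 2
    push_cast
    rw [show 2 * ((m : ℝ) + 1) + 1 = 2 * m + 3 by ring]
    ring

lemma hasSum_swap {F : ℕ × ℕ → ℝ} (hF : Summable F) {f g : ℕ → ℝ} {S : ℝ}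
    (hf : ∀ k, HasSum (fun m => F (k, m)) (f k)) (hg : ∀ m, HasSum (fun k => F (k, m)) (g m))
    (hS : HasSum g S) : HasSum f S := by
  have h1 := hF.hasSum.prod_fiberwise hf
  have h2 := ((Equiv.prodComm ℕ ℕ).hasSum_iff.2 hF.hasSum).prod_fiberwise hg
  rwa [h2.unique hS] at h1

lemma hasSum_swap_of_nonneg {F : ℕ × ℕ → ℝ} (hF : 0 ≤ F) {f g : ℕ → ℝ} {S : ℝ}
    (hf : ∀ k, HasSum (fun m => F (k, m)) (f k)) (hg : ∀ m, HasSum (fun k => F (k, m)) (g m))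
    (hS : HasSum g S) : HasSum f S := by
  refine hasSum_swap ?_ hf hg hS
  rw [← (Equiv.prodComm ℕ ℕ).summable_iff]
  refine (summable_prod_of_nonneg (f := F ∘ Equiv.prodComm ℕ ℕ) fun p => hF (Equiv.prodComm ℕ ℕ p)).2
    ⟨fun m => (hg m).summable, hS.summable.congr fun m => ((hg m).tsum_eq).symm⟩

lemma summable_kernel :
    Summable fun p : ℕ × ℕ => (1 : ℝ) / ((2 * ((p.1 : ℝ) + 1)) ^ 2 * (2 * (p.2 : ℝ) + 1)
      * ((2 * ((p.1 : ℝ) + 1)) ^ 2 - (2 * (p.2 : ℝ) + 1) ^ 2)) := by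
  have h1 : Summable fun n : ℕ => (1 : ℝ) / ((n : ℝ) + 1) ^ (3 / 2 : ℝ) := by
    have := (summable_nat_add_iff 1).2 (Real.summable_one_div_nat_rpow (p := 3 / 2).2 (by norm_num))
    simpa using this
  refine Summable.of_norm_bounded (h1.mul_of_nonneg h1 (fun _ => by positivity)
    fun _ => by positivity) ?_
  rintro ⟨k, m⟩
  have hd := one_le_abs_even_sub_odd k m
  have e : ∀ x : ℝ, 0 < x → x ^ (3 / 2 : ℝ) = x * √x := fun x hx => by
    rw [show (3 / 2 : ℝ) = 1 + 1 / 2 by norm_num, Real.rpow_add hx, Real.rpow_one,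
      Real.sqrt_eq_rpow]
  have hk : (0 : ℝ) < (k : ℝ) + 1 := by positivity
  have hm : (0 : ℝ) < (m : ℝ) + 1 := by positivity
  rw [e _ hk, e _ hm, Real.norm_eq_abs, one_div_mul_one_div, abs_div, abs_one]
  have hp : (0 : ℝ) < ((k : ℝ) + 1) * √((k : ℝ) + 1) * (((m : ℝ) + 1) * √((m : ℝ) + 1)) := by
    positivity
  refine one_div_le_one_div_of_le hp ?_
  have hsum : √((k : ℝ) + 1) * √((m : ℝ) + 1) ≤ 2 * ((k : ℝ) + 1) + (2 * (m : ℝ) + 1) := by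
    have := Real.sq_sqrt hk.le
    have := Real.sq_sqrt hm.le
    nlinarith [sq_nonneg (√((k : ℝ) + 1) - √((m : ℝ) + 1)), (Nat.cast_nonneg k : (0:ℝ) ≤ k),
      (Nat.cast_nonneg m : (0:ℝ) ≤ m)]
  rw [sq_sub_sq, abs_mul ((2 * ((k : ℝ) + 1)) ^ 2 * (2 * (m : ℝ) + 1)),
    abs_mul (2 * ((k : ℝ) + 1) + (2 * (m : ℝ) + 1)), abs_of_pos (by positivity : (0:ℝ) <
    (2 * ((k : ℝ) + 1)) ^ 2 * (2 * (m : ℝ) + 1)), abs_of_pos (by positivity : (0:ℝ) <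
    2 * ((k : ℝ) + 1) + (2 * (m : ℝ) + 1))]
  calc _ = (((k : ℝ) + 1) * ((m : ℝ) + 1)) * (√((k : ℝ) + 1) * √((m : ℝ) + 1)) := by ring
    _ ≤ ((2 * ((k : ℝ) + 1)) ^ 2 * (2 * (m : ℝ) + 1))
        * (2 * ((k : ℝ) + 1) + (2 * (m : ℝ) + 1)) := by
      refine mul_le_mul ?_ hsum (by positivity) (by positivity)
      refine mul_le_mul ?_ ?_ (by positivity) (by positivity) <;> nlinarith
    _ ≤ _ := by
      refine mul_le_mul_of_nonneg_left ?_ (by positivity)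
      exact le_mul_of_one_le_right (by positivity) hd

lemma hasSum_h_kernel (k : ℕ) :
    HasSum (fun m : ℕ => (1 : ℝ) / ((2 * ((k : ℝ) + 1)) ^ 2 * (2 * (m : ℝ) + 1)
      * ((2 * ((k : ℝ) + 1)) ^ 2 - (2 * (m : ℝ) + 1) ^ 2)))
      (h (k + 1) / (2 * ((k : ℝ) + 1)) ^ 4) := by
  rw [(summable_kernel.prod_factor k).hasSum_iff_tendsto_nat]
  have := (tendsto_sum_h (k + 1)).div_const ((2 * ((k : ℝ) + 1)) ^ 4)
  refine this.congr fun M => ?_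
  rw [Finset.sum_div]
  refine Finset.sum_congr rfl fun m _ => ?_
  have h1 := even_sub_odd_ne_zero k m
  have h2 : 2 * (m : ℝ) + 1 - 2 * ((k : ℝ) + 1) ≠ 0 := by
    rw [← neg_sub]; exact neg_ne_zero.2 h1
  have h3 : 2 * ((k : ℝ) + 1) + (2 * (m : ℝ) + 1) ≠ 0 := by positivity
  have h4 : 2 * (m : ℝ) + 1 + 2 * ((k : ℝ) + 1) ≠ 0 := by positivity
  have h5 : (2 * ((k : ℝ) + 1)) ≠ 0 := by positivity
  have h6 : 2 * (m : ℝ) + 1 ≠ 0 := by positivity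
  push_cast
  rw [sq_sub_sq, ← neg_sub (2 * (m : ℝ) + 1) (2 * ((k : ℝ) + 1))]
  generalize 2 * (m : ℝ) + 1 = a at *
  generalize 2 * ((k : ℝ) + 1) = N at *
  field_simp
  ring

lemma hasSum_inv_odd_sq_sub (m : ℕ) :
    HasSum (fun k : ℕ => (1 : ℝ) / ((2 * ((k : ℝ) + 1)) ^ 2 - (2 * (m : ℝ) + 1) ^ 2))
      (1 / (2 * (2 * (m : ℝ) + 1) ^ 2)) := by
  have h6 : 2 * (m : ℝ) + 1 ≠ 0 := by positivity
  have hs : Summable fun k : ℕ =>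
      (1 : ℝ) / ((2 * ((k : ℝ) + 1)) ^ 2 - (2 * (m : ℝ) + 1) ^ 2) := by
    have ha := (hasSum_sq_odd_sub m).summable
    have hb := (hasSum_sq_odd_add (m + 1)).summable
    refine Summable.of_norm_bounded (ha.add hb) fun k => ?_
    rw [sq_sub_sq, Real.norm_eq_abs, abs_div, abs_one, abs_mul]
    have h1 := one_le_abs_even_sub_odd k m
    have e1 : (2 * (k : ℝ) + 1 - 2 * m) ^ 2 = |2 * ((k : ℝ) + 1) - (2 * (m : ℝ) + 1)| ^ 2 := by
      rw [sq_abs]; ring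
    have e2 : (2 * (k : ℝ) + 1 + 2 * (m + 1 : ℕ)) ^ 2
        = |2 * ((k : ℝ) + 1) + (2 * (m : ℝ) + 1)| ^ 2 := by
      rw [sq_abs]; push_cast; ring
    rw [e1, e2]
    have hp : 0 < |2 * ((k : ℝ) + 1) + (2 * (m : ℝ) + 1)| := abs_pos.2 (by positivity)
    have hq : 0 < |2 * ((k : ℝ) + 1) - (2 * (m : ℝ) + 1)| := by linarith
    generalize |2 * ((k : ℝ) + 1) + (2 * (m : ℝ) + 1)| = p at *
    generalize |2 * ((k : ℝ) + 1) - (2 * (m : ℝ) + 1)| = q at *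
    have : 1 / (p * q) = (1 / p) * (1 / q) := by field_simp
    rw [this, ← one_div_pow, ← one_div_pow]
    nlinarith [sq_nonneg (1 / p - 1 / q), sq_nonneg (1 / p), sq_nonneg (1 / q)]
  rw [hs.hasSum_iff_tendsto_nat]
  have := (tendsto_sum_inv_even_sq_sub m).div_const (2 * (2 * (m : ℝ) + 1))
  convert this using 1
  · ext K
    rw [Finset.sum_div]
    refine Finset.sum_congr rfl fun k _ => ?_
    have h1 := even_sub_odd_ne_zero k m
    have h3 : 2 * ((k : ℝ) + 1) + (2 * (m : ℝ) + 1) ≠ 0 := by positivity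
    push_cast
    rw [sq_sub_sq, show 2 * (k : ℝ) + 1 - 2 * m = 2 * ((k : ℝ) + 1) - (2 * (m : ℝ) + 1) by ring,
      show 2 * (k : ℝ) + 1 + 2 * (m + 1) = 2 * ((k : ℝ) + 1) + (2 * (m : ℝ) + 1) by ring]
    generalize 2 * (m : ℝ) + 1 = a at *
    generalize 2 * ((k : ℝ) + 1) = N at *
    field_simp
    ring
  · congr 1
    field_simp

lemma hasSum_inv_even_sq : HasSum (fun k : ℕ => (1 : ℝ) / (2 * ((k : ℝ) + 1)) ^ 2)
    (zeta 2 / 4) := by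
  refine hasSum_of_eq ((hasSum_zeta (s := 2) one_lt_two).div_const 4) (fun k => ?_) rfl
  rw [mul_pow]
  field_simp
  norm_num

/-- `∑ h_k / (2 k) ^ 4`. -/
lemma hasSum_h_div_pow_four :
    HasSum (fun k : ℕ => h (k + 1) / (2 * ((k : ℝ) + 1)) ^ 4)
      (oddZeta 5 / 2 - zeta 2 / 4 * oddZeta 3) := by
  refine hasSum_swap summable_kernel hasSum_h_kernel
    (g := fun m => 1 / (2 * (m : ℝ) + 1) ^ 5 / 2 - zeta 2 / 4 * (1 / (2 * (m : ℝ) + 1) ^ 3))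
    (fun m => ?_) ?_
  · have := ((hasSum_inv_odd_sq_sub m).sub hasSum_inv_even_sq).div_const
      ((2 * (m : ℝ) + 1) ^ 3)
    have h6 : 2 * (m : ℝ) + 1 ≠ 0 := by positivity
    refine hasSum_of_eq this (fun k => ?_) ?_
    · have h1 := even_sub_odd_ne_zero k m
      have h3 : 2 * ((k : ℝ) + 1) + (2 * (m : ℝ) + 1) ≠ 0 := by positivity
      have h5 : (2 * ((k : ℝ) + 1)) ≠ 0 := by positivity
      simp only [sq_sub_sq]
      generalize 2 * (m : ℝ) + 1 = a at *
      generalize 2 * ((k : ℝ) + 1) = N at *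
      field_simp
      ring
    · field_simp
  · exact ((hasSum_oddZeta (by norm_num)).div_const 2).sub
      ((hasSum_oddZeta (by norm_num)).mul_left _)

lemma hasSum_inv_odd_sq_sub_sq (m : ℕ) :
    HasSum (fun k : ℕ => (1 : ℝ) / ((2 * ((k : ℝ) + 1)) ^ 2 - (2 * (m : ℝ) + 1) ^ 2) ^ 2)
      ((oddZeta 2 / (2 * (m : ℝ) + 1) ^ 2 - 1 / (2 * (m : ℝ) + 1) ^ 4) / 2) := by
  have h6 : 2 * (m : ℝ) + 1 ≠ 0 := by positivity
  have := ((((hasSum_sq_odd_sub m).add (hasSum_sq_odd_add (m + 1))).div_const 2).sub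
    (hasSum_inv_odd_sq_sub m)).div_const (2 * (2 * (m : ℝ) + 1) ^ 2)
  refine hasSum_of_eq this (fun k => ?_) ?_
  · have h1 := even_sub_odd_ne_zero k m
    have h3 : 2 * ((k : ℝ) + 1) + (2 * (m : ℝ) + 1) ≠ 0 := by positivity
    push_cast
    rw [sq_sub_sq, show 2 * (k : ℝ) + 1 - 2 * m = 2 * ((k : ℝ) + 1) - (2 * (m : ℝ) + 1) by ring,
      show 2 * (k : ℝ) + 1 + 2 * (m + 1) = 2 * ((k : ℝ) + 1) + (2 * (m : ℝ) + 1) by ring]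
    generalize 2 * (m : ℝ) + 1 = a at *
    generalize 2 * ((k : ℝ) + 1) = N at *
    field_simp
    ring
  · simp only [h2, Finset.sum_range_succ]
    field_simp
    ring

/-- `∑ h_k^{(2)} / (2 k) ^ 3`. -/
lemma hasSum_h2_div_pow_three :
    HasSum (fun k : ℕ => h2 (k + 1) / (2 * ((k : ℝ) + 1)) ^ 3)
      (zeta 2 / 2 * oddZeta 3 + oddZeta 2 * oddZeta 3 - 2 * oddZeta 5) := by
  refine hasSum_swap_of_nonneg (F := fun p => 2 * (2 * (p.2 : ℝ) + 1) /
    ((2 * ((p.1 : ℝ) + 1)) ^ 2 * ((2 * ((p.1 : ℝ) + 1)) ^ 2 - (2 * (p.2 : ℝ) + 1) ^ 2) ^ 2))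
    (fun p => by simp only [Pi.zero_apply]; positivity) (fun k => ?_)
    (g := fun m => zeta 2 / 2 * (1 / (2 * (m : ℝ) + 1) ^ 3)
      + oddZeta 2 * (1 / (2 * (m : ℝ) + 1) ^ 3) - 2 * (1 / (2 * (m : ℝ) + 1) ^ 5))
    (fun m => ?_) ?_
  · have := ((hasSum_sq_odd_sub (k + 1)).sub (hasSum_sq_odd_add (k + 1))).div_const
      (2 * (2 * ((k : ℝ) + 1)) ^ 3)
    have h5 : (2 * ((k : ℝ) + 1)) ≠ 0 := by positivity
    refine hasSum_of_eq this (fun m => ?_) ?_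
    · have h1 := even_sub_odd_ne_zero k m
      have h2 : 2 * (m : ℝ) + 1 - 2 * ((k : ℝ) + 1) ≠ 0 := by
        rw [← neg_sub]; exact neg_ne_zero.2 h1
      have h3 : 2 * (m : ℝ) + 1 + 2 * ((k : ℝ) + 1) ≠ 0 := by positivity
      push_cast
      rw [← neg_sub ((2 * (m : ℝ) + 1) ^ 2), neg_sq, sq_sub_sq]
      generalize 2 * (m : ℝ) + 1 = a at *
      generalize 2 * ((k : ℝ) + 1) = N at *
      field_simp
      ring
    · field_simp
      ring
  · have h6 : 2 * (m : ℝ) + 1 ≠ 0 := by positivity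
    have := ((((hasSum_inv_even_sq).sub (hasSum_inv_odd_sq_sub m)).div_const
      ((2 * (m : ℝ) + 1) ^ 4)).add ((hasSum_inv_odd_sq_sub_sq m).div_const
      ((2 * (m : ℝ) + 1) ^ 2))).mul_left (2 * (2 * (m : ℝ) + 1))
    refine hasSum_of_eq this (fun k => ?_) ?_
    · have h1 := even_sub_odd_ne_zero k m
      have h3 : 2 * ((k : ℝ) + 1) + (2 * (m : ℝ) + 1) ≠ 0 := by positivity
      have h5 : (2 * ((k : ℝ) + 1)) ≠ 0 := by positivity
      simp only [sq_sub_sq]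
      generalize 2 * (m : ℝ) + 1 = a at *
      generalize 2 * ((k : ℝ) + 1) = N at *
      field_simp
      ring
    · field_simp
      ring
  · exact (((hasSum_oddZeta (by norm_num)).mul_left _).add
      ((hasSum_oddZeta (by norm_num)).mul_left _)).sub ((hasSum_oddZeta (by norm_num)).mul_left _)

lemma H_succ (k : ℕ) : H (k + 1) = H k + 1 / ((k : ℝ) + 1) := by
  rw [H, Finset.sum_range_succ, ← H]

lemma h_succ (k : ℕ) : h (k + 1) = h k + 1 / (2 * (k : ℝ) + 1) := by
  rw [h, Finset.sum_range_succ, ← h]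

lemma H_nonneg (k : ℕ) : 0 ≤ H k := Finset.sum_nonneg fun _ _ => by positivity

lemma h_nonneg (k : ℕ) : 0 ≤ h k := Finset.sum_nonneg fun _ _ => by positivity

lemma h_le_H (k : ℕ) : h k ≤ H k := by
  refine Finset.sum_le_sum fun j _ => one_div_le_one_div_of_le (by positivity) ?_
  have : (0 : ℝ) ≤ j := Nat.cast_nonneg j
  linarith

lemma exp_H_le (k : ℕ) : exp (H (k + 1) / 2) ≤ exp (1 / 2) * ((k : ℝ) + 1) ^ (1 / 2 : ℝ) := by
  have h1 : H (k + 1) ≤ 1 + log ((k : ℝ) + 1) := by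
    have := harmonic_le_one_add_log (k + 1)
    simpa [harmonic, H] using this
  have h0 : (0 : ℝ) < (k : ℝ) + 1 := by positivity
  rw [Real.rpow_def_of_pos h0, ← Real.exp_add, Real.exp_le_exp]
  linarith

lemma pow_three_le_exp {x : ℝ} (hx : 0 ≤ x) : x ^ 3 ≤ 1296 * exp (x / 6) := by
  have := Real.pow_div_factorial_le_exp (x / 6) (by positivity) 3
  norm_num [Nat.factorial] at this
  nlinarith

lemma summable_exp_H : Summable fun k : ℕ => exp (H (k + 1) / 2) / ((k : ℝ) + 1) ^ 2 := by
  have h1 : Summable fun n : ℕ => (1 : ℝ) / ((n : ℝ) + 1) ^ (3 / 2 : ℝ) := by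
    have := (summable_nat_add_iff 1).2 (Real.summable_one_div_nat_rpow (p := 3 / 2).2 (by norm_num))
    simpa using this
  refine Summable.of_nonneg_of_le (fun k => by positivity) (fun k => ?_) (h1.mul_left (exp (1 / 2)))
  have h0 : (0 : ℝ) < (k : ℝ) + 1 := by positivity
  rw [div_le_iff₀ (by positivity)]
  refine (exp_H_le k).trans_eq ?_
  rw [mul_assoc]
  congr 1
  rw [one_div (((k : ℝ) + 1) ^ (3 / 2 : ℝ)), ← Real.rpow_neg h0.le, ← Real.rpow_natCast, ← Real.rpow_add h0]
  norm_num

lemma tendsto_exp_H_div :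
    Filter.Tendsto (fun k : ℕ => exp (H (k + 1) / 2) / ((k : ℝ) + 1)) Filter.atTop (nhds 0) := by
  have h1 : Filter.Tendsto (fun k : ℕ => exp (1 / 2) * ((k : ℝ) + 1) ^ (-(1 / 2) : ℝ))
      Filter.atTop (nhds 0) := by
    have := ((tendsto_rpow_neg_atTop (y := 1 / 2) (by norm_num)).comp
      (Filter.tendsto_atTop_add_const_right Filter.atTop (1 : ℝ)
        tendsto_natCast_atTop_atTop)).const_mul (exp (1 / 2))
    simpa using this
  refine squeeze_zero (fun k => by positivity) (fun k => ?_) h1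
  have h0 : (0 : ℝ) < (k : ℝ) + 1 := by positivity
  rw [div_le_iff₀ h0]
  refine (exp_H_le k).trans_eq ?_
  rw [mul_assoc]
  congr 1
  rw [← Real.rpow_add_one h0.ne']
  norm_num

/-- The product `(1 - s)_k / (s)_k` of rising factorials. -/
noncomputable def pochRatio (k : ℕ) (s : ℝ) : ℝ := ∏ j ∈ Finset.range k, ((j : ℝ) + 1 - s) / (s + j)

lemma pochRatio_zero (s : ℝ) : pochRatio 0 s = 1 := by simp [pochRatio]

lemma pochRatio_succ (k : ℕ) (s : ℝ) :
    pochRatio (k + 1) s = pochRatio k s * (((k : ℝ) + 1 - s) / (s + k)) := by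
  rw [pochRatio, Finset.prod_range_succ, ← pochRatio]

lemma pochRatio_succ_add_one {s : ℝ} (hs : 0 < s) (k : ℕ) :
    pochRatio (k + 1) (s + 1) = -s ^ 2 * pochRatio k s / ((s + k) * (s + k + 1)) := by
  induction k with
  | zero => simp [pochRatio]; field_simp
  | succ k ih =>
    rw [pochRatio_succ (k + 1), ih, pochRatio_succ]
    push_cast
    have h1 : s + (k : ℝ) ≠ 0 := by positivity
    have h2 : s + (k : ℝ) + 1 ≠ 0 := by positivity
    have h3 : s + (k : ℝ) + 1 + 1 ≠ 0 := by positivity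
    rw [show s + 1 + ((k : ℝ) + 1) = s + k + 1 + 1 by ring,
      show s + ((k : ℝ) + 1) = s + k + 1 by ring]
    field_simp
    ring

lemma abs_pochRatio_le {s : ℝ} (hs : 15 / 32 ≤ s) (k : ℕ) : |pochRatio k s| ≤ exp (H k / 6) := by
  rw [pochRatio, Finset.abs_prod, H, Finset.sum_div, Real.exp_sum]
  refine Finset.prod_le_prod (fun _ _ => abs_nonneg _) fun j _ => ?_
  have hj : (0 : ℝ) ≤ j := Nat.cast_nonneg j
  have h0 : (0 : ℝ) < s + j := by linarith
  refine le_trans ?_ (Real.add_one_le_exp _)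
  rw [abs_div, abs_of_pos h0, div_le_iff₀ h0]
  have h2 : 1 / 16 ≤ 1 / ((j : ℝ) + 1) / 6 * (s + j) := by
    rw [div_div, one_div_mul_eq_div, le_div_iff₀ (by positivity)]
    linarith
  rw [add_mul]
  refine abs_le.2 ⟨?_, ?_⟩ <;> linarith

/-- The coefficients of the auxiliary series `∑ c_k (1 - s)_{k + 1} / (s)_{k + 1}`. -/
noncomputable def auxCoeff (k : ℕ) : ℝ := 2 * (2 * H (k + 1) - 1 / ((k : ℝ) + 1)) / ((k : ℝ) + 1) ^ 2

lemma auxCoeff_nonneg (k : ℕ) : 0 ≤ auxCoeff k := by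
  have := H_nonneg k
  have : (0 : ℝ) ≤ 1 / ((k : ℝ) + 1) := by positivity
  refine div_nonneg ?_ (by positivity)
  rw [H_succ]
  linarith

lemma auxCoeff_le (k : ℕ) : auxCoeff k ≤ 4 * H (k + 1) / ((k : ℝ) + 1) ^ 2 := by
  have : (0 : ℝ) ≤ 1 / ((k : ℝ) + 1) := by positivity
  exact div_le_div_of_nonneg_right (by linarith) (by positivity)

lemma one_le_H_succ (k : ℕ) : 1 ≤ H (k + 1) := by
  induction k with
  | zero => simp [H]
  | succ k ih =>
    rw [H_succ]
    have : (0 : ℝ) ≤ 1 / (((k + 1 : ℕ) : ℝ) + 1) := by positivity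
    linarith

lemma auxCoeff_mul_le (k : ℕ) :
    auxCoeff k * (H (k + 1) ^ 2 * exp (H (k + 1) / 3))
      ≤ 5184 * (exp (H (k + 1) / 2) / ((k : ℝ) + 1) ^ 2) := by
  have h1 := H_nonneg (k + 1)
  calc _ ≤ 4 * H (k + 1) / ((k : ℝ) + 1) ^ 2 * (H (k + 1) ^ 2 * exp (H (k + 1) / 3)) := by
        gcongr; exact auxCoeff_le k
    _ = 4 * (H (k + 1) ^ 3 * exp (H (k + 1) / 3)) / ((k : ℝ) + 1) ^ 2 := by ring
    _ ≤ 4 * (1296 * exp (H (k + 1) / 6) * exp (H (k + 1) / 3)) / ((k : ℝ) + 1) ^ 2 := by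
        gcongr; exact pow_three_le_exp h1
    _ = _ := by
        rw [mul_assoc 1296, ← Real.exp_add,
          show H (k + 1) / 6 + H (k + 1) / 3 = H (k + 1) / 2 by ring]
        ring

lemma norm_auxCoeff_mul_pochRatio_le {s : ℝ} (hs : 15 / 32 ≤ s) (k : ℕ) :
    ‖auxCoeff k * pochRatio (k + 1) s‖ ≤ 5184 * (exp (H (k + 1) / 2) / ((k : ℝ) + 1) ^ 2) := by
  refine le_trans ?_ (auxCoeff_mul_le k)
  rw [norm_mul, Real.norm_eq_abs, Real.norm_eq_abs, abs_of_nonneg (auxCoeff_nonneg k)]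
  refine mul_le_mul_of_nonneg_left ?_ (auxCoeff_nonneg k)
  have h1 := one_le_H_succ k
  calc _ ≤ exp (H (k + 1) / 6) := abs_pochRatio_le hs _
    _ ≤ exp (H (k + 1) / 3) := by
        rw [Real.exp_le_exp]; linarith
    _ ≤ _ := le_mul_of_one_le_left (by positivity) (one_le_pow₀ h1)

/-- The auxiliary series `∑ c_k (1 - s)_{k + 1} / (s)_{k + 1}`. -/
noncomputable def auxSeries (s : ℝ) : ℝ := ∑' k : ℕ, auxCoeff k * pochRatio (k + 1) s

lemma hasSum_auxSeries {s : ℝ} (hs : 15 / 32 ≤ s) :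
    HasSum (fun k => auxCoeff k * pochRatio (k + 1) s) (auxSeries s) :=
  (Summable.of_norm_bounded (summable_exp_H.mul_left 5184)
    (norm_auxCoeff_mul_pochRatio_le hs)).hasSum

lemma auxCoeff_mul_pochRatio_sub {s : ℝ} (hs : 0 < s) (k : ℕ) :
    auxCoeff k * pochRatio (k + 1) s - auxCoeff k * pochRatio (k + 1) (s + 1)
      = (2 * H k + 1 / s) * pochRatio k s / (s + k) / s
        - (2 * H (k + 1) + 1 / s) * pochRatio (k + 1) s / (s + (k + 1 : ℕ)) / s := by
  rw [pochRatio_succ_add_one hs, pochRatio_succ, auxCoeff, H_succ]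
  push_cast
  have h1 : s + (k : ℝ) ≠ 0 := by positivity
  have h2 : s + (k : ℝ) + 1 ≠ 0 := by positivity
  have h3 : (k : ℝ) + 1 ≠ 0 := by positivity
  rw [← add_assoc]
  field_simp
  ring

lemma auxSeries_sub {s : ℝ} (hs : 15 / 32 ≤ s) : auxSeries s - auxSeries (s + 1) = 1 / s ^ 3 := by
  have hs0 : 0 < s := by linarith
  have h1 := ((hasSum_auxSeries hs).sub (hasSum_auxSeries (s := s + 1)
    (by linarith))).tendsto_sum_nat
  simp only [auxCoeff_mul_pochRatio_sub hs0] at h1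
  have e := fun n => Finset.sum_range_sub'
    (fun k : ℕ => (2 * H k + 1 / s) * pochRatio k s / (s + k) / s) n
  simp only [e] at h1
  have h3 : Filter.Tendsto (fun k : ℕ => (2 * H k + 1 / s) * pochRatio k s / (s + k) / s)
      Filter.atTop (nhds 0) := by
    rw [← Filter.tendsto_add_atTop_iff_nat 1]
    refine squeeze_zero_norm (fun k => ?_)
      ((tendsto_exp_H_div.const_mul ((2 + 1 / s) * 1296 / s)).trans (by simp))
    have hH := one_le_H_succ k
    have hk : (0 : ℝ) < k + 1 := by positivity
    have h5 := abs_pochRatio_le hs (k + 1)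
    rw [Real.norm_eq_abs, abs_div, abs_of_pos hs0, abs_div, abs_mul,
      abs_of_pos (by positivity : 0 < s + ((k + 1 : ℕ) : ℝ)), abs_of_pos (by positivity :
        0 < 2 * H (k + 1) + 1 / s)]
    have h6 : 2 * H (k + 1) + 1 / s ≤ (2 + 1 / s) * (1296 * exp (H (k + 1) / 6)) := by
      have h7 := pow_three_le_exp (by linarith : 0 ≤ H (k + 1))
      have h8 : H (k + 1) ≤ H (k + 1) ^ 3 := le_self_pow₀ hH (by norm_num)
      calc _ ≤ (2 + 1 / s) * H (k + 1) := by
            have : 0 < 1 / s := by positivity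
            nlinarith
        _ ≤ _ := by gcongr; linarith
    have h9 : (k : ℝ) + 1 ≤ s + ((k + 1 : ℕ) : ℝ) := by push_cast; linarith
    generalize s + ((k + 1 : ℕ) : ℝ) = d at h9 ⊢
    calc _ ≤ (2 + 1 / s) * (1296 * exp (H (k + 1) / 6)) * exp (H (k + 1) / 6)
          / ((k : ℝ) + 1) / s := by
          gcongr
      _ = (2 + 1 / s) * 1296 * exp (H (k + 1) / 3) / ((k : ℝ) + 1) / s := by
          rw [show H (k + 1) / 3 = H (k + 1) / 6 + H (k + 1) / 6 by ring, Real.exp_add]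
          ring
      _ ≤ (2 + 1 / s) * 1296 * exp (H (k + 1) / 2) / ((k : ℝ) + 1) / s := by
          gcongr
          norm_num
      _ = _ := by ring
  have h2 := tendsto_nhds_unique h1 (h3.const_sub _)
  rw [h2]
  simp [H, pochRatio]
  field_simp

lemma tendsto_pochRatio (k : ℕ) (s : ℝ) :
    Filter.Tendsto (fun n : ℕ => pochRatio k (s + n)) Filter.atTop (nhds ((-1) ^ k)) := by
  induction k with
  | zero => simp [pochRatio]
  | succ k ih =>
    simp only [pochRatio_succ]
    rw [pow_succ]
    refine ih.mul ?_
    have h1 : Filter.Tendsto (fun n : ℕ => s + n + k) Filter.atTop Filter.atTop :=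
      Filter.tendsto_atTop_add_const_right _ _
        (Filter.tendsto_atTop_add_const_left _ _ tendsto_natCast_atTop_atTop)
    have h2 := (h1.inv_tendsto_atTop.const_mul (2 * (k : ℝ) + 1)).add_const (-1)
    rw [mul_zero, zero_add] at h2
    refine h2.congr' ?_
    filter_upwards [h1.eventually_gt_atTop 0] with n hn
    simp only [Pi.inv_apply]
    field_simp
    ring

lemma hasSum_inv_add_pow_three {s : ℝ} (hs : 15 / 32 ≤ s) :
    HasSum (fun i : ℕ => 1 / (s + i) ^ 3)
      (auxSeries s - ∑' k : ℕ, auxCoeff k * (-1) ^ (k + 1)) := by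
  have hs0 : 0 < s := by linarith
  rw [hasSum_iff_tendsto_nat_of_nonneg (fun i => by positivity)]
  have h1 : ∀ n : ℕ, ∑ i ∈ Finset.range n, 1 / (s + i) ^ 3 = auxSeries s - auxSeries (s + n) := by
    intro n
    induction n with
    | zero => simp
    | succ n ih =>
      have hn : (0 : ℝ) ≤ n := Nat.cast_nonneg n
      rw [Finset.sum_range_succ, ih, ← auxSeries_sub (by linarith)]
      push_cast
      rw [← add_assoc]
      ring
  simp only [h1]
  refine Filter.Tendsto.const_sub _ ?_
  refine tendsto_tsum_of_dominated_convergence (summable_exp_H.mul_left 5184)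
    (fun k => (tendsto_pochRatio (k + 1) s).const_mul _) (Filter.Eventually.of_forall fun n k => ?_)
  have hn : (0 : ℝ) ≤ n := Nat.cast_nonneg n
  exact norm_auxCoeff_mul_pochRatio_le (by linarith) k

lemma pochRatio_half_add (k : ℕ) (z : ℝ) :
    pochRatio k (1 / 2 + z) = (pochRatio k (1 / 2 - z))⁻¹ := by
  rw [pochRatio, pochRatio, ← Finset.prod_inv_distrib]
  refine Finset.prod_congr rfl fun j _ => ?_
  rw [inv_div]
  congr 1 <;> ring

lemma pochRatio_half (k : ℕ) : pochRatio k (1 / 2) = 1 := by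
  refine Finset.prod_eq_one fun j _ => ?_
  have : (1 / 2 : ℝ) + j ≠ 0 := by positivity
  rw [show (j : ℝ) + 1 - 1 / 2 = 1 / 2 + j by ring, div_self this]

lemma hasDerivAt_pochRatio_half (k : ℕ) :
    HasDerivAt (fun z => pochRatio k (1 / 2 - z)) (4 * h k) 0 := by
  induction k with
  | zero => simpa [pochRatio, h] using hasDerivAt_const (0 : ℝ) (1 : ℝ)
  | succ k ih =>
    simp only [pochRatio_succ]
    have hk : (1 / 2 : ℝ) - 0 + k ≠ 0 := by
      rw [sub_zero]; positivity
    have h1 := ((hasDerivAt_id (0 : ℝ)).const_sub (1 / 2)).const_sub ((k : ℝ) + 1)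
    have h3 := ih.mul (h1.div (((hasDerivAt_id (0 : ℝ)).const_sub (1 / 2)).add_const (k : ℝ)) hk)
    refine h3.congr_deriv ?_
    simp only [sub_zero, pochRatio_half, id, h_succ, Pi.div_apply]
    rw [sub_zero] at hk
    have : (2 * (k : ℝ) + 1) ≠ 0 := by positivity
    have : (1 + 2 * (k : ℝ)) ≠ 0 := by positivity
    rw [show (k : ℝ) + 1 - 1 / 2 = 1 / 2 + k by ring, div_self hk]
    field_simp
    ring

lemma one_le_pochRatio_half_sub {z : ℝ} (hz : 0 ≤ z) (hz' : z ≤ 1 / 32) (k : ℕ) :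
    1 ≤ pochRatio k (1 / 2 - z) := by
  induction k with
  | zero => rw [pochRatio_zero]
  | succ k ih =>
    have hk : (0 : ℝ) ≤ k := Nat.cast_nonneg k
    rw [pochRatio_succ]
    refine one_le_mul_of_one_le_of_one_le ih ?_
    rw [one_le_div (by linarith)]
    linarith

lemma pochRatio_half_sub_le {z : ℝ} (hz : 0 ≤ z) (hz' : z ≤ 1 / 32) (k : ℕ) :
    pochRatio k (1 / 2 - z) ≤ exp (16 / 3 * z * H k) := by
  rw [pochRatio, H, Finset.mul_sum, Real.exp_sum]
  have hp : ∀ j : ℕ, 0 < 1 / 2 - z + j := fun j => by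
    have : (0 : ℝ) ≤ j := Nat.cast_nonneg j
    linarith
  refine Finset.prod_le_prod (fun j _ => ?_) fun j _ => ?_
  · have := hp j
    exact div_nonneg (by linarith) this.le
  · have hj : (0 : ℝ) ≤ j := Nat.cast_nonneg j
    refine le_trans ?_ (Real.add_one_le_exp _)
    rw [div_le_iff₀ (hp j)]
    have h2 : 2 * z ≤ 16 / 3 * z * (1 / ((j : ℝ) + 1)) * (1 / 2 - z + j) := by
      rw [mul_one_div, div_mul_eq_mul_div, le_div_iff₀ (by positivity)]
      nlinarith
    linarith

lemma sub_one_sq_div_le {z : ℝ} (hz : 0 ≤ z) (hz' : z ≤ 1 / 32) (k : ℕ) :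
    (pochRatio k (1 / 2 - z) - 1) ^ 2 / pochRatio k (1 / 2 - z)
      ≤ z ^ 2 * (32 * (H k ^ 2 * exp (H k / 3))) := by
  have h1 := one_le_pochRatio_half_sub hz hz' k
  have h2 := pochRatio_half_sub_le hz hz' k
  have hH := H_nonneg k
  have h3 : pochRatio k (1 / 2 - z) - 1 ≤ 16 / 3 * z * H k * exp (H k / 6) := by
    have h4 : exp (16 / 3 * z * H k) * (1 - 16 / 3 * z * H k) ≤ 1 := by
      have := Real.add_one_le_exp (-(16 / 3 * z * H k))
      calc _ ≤ exp (16 / 3 * z * H k) * exp (-(16 / 3 * z * H k)) := by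
            gcongr; linarith
        _ = 1 := by rw [← Real.exp_add]; simp
    have h5 : exp (16 / 3 * z * H k) ≤ exp (H k / 6) := by
      rw [Real.exp_le_exp]; nlinarith
    have h6 : 0 ≤ 16 / 3 * z * H k := by positivity
    nlinarith
  calc _ ≤ (pochRatio k (1 / 2 - z) - 1) ^ 2 := div_le_self (sq_nonneg _) h1
    _ ≤ (16 / 3 * z * H k * exp (H k / 6)) ^ 2 := by
        gcongr
    _ = z ^ 2 * (256 / 9 * (H k ^ 2 * exp (H k / 3))) := by
        rw [show H k / 3 = H k / 6 + H k / 6 by ring, Real.exp_add]; ring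
    _ ≤ _ := by
        gcongr
        norm_num

lemma pochRatio_second_difference {z : ℝ} (hz : 0 ≤ z) (hz' : z ≤ 1 / 32) (k : ℕ) :
    pochRatio k (1 / 2 + z) + pochRatio k (1 / 2 - z) - 2 * pochRatio k (1 / 2)
      = (pochRatio k (1 / 2 - z) - 1) ^ 2 / pochRatio k (1 / 2 - z) := by
  have : pochRatio k (1 / 2 - z) ≠ 0 := by
    have := one_le_pochRatio_half_sub hz hz' k
    positivity
  rw [pochRatio_half_add, pochRatio_half]
  generalize pochRatio k (1 / 2 - z) = t at *
  field_simp
  ring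

lemma tendsto_auxSeries_second_difference :
    Filter.Tendsto (fun z => (auxSeries (1 / 2 + z) + auxSeries (1 / 2 - z)
      - 2 * auxSeries (1 / 2)) / z ^ 2) (nhdsWithin 0 (Set.Ioi 0))
      (nhds (∑' k : ℕ, auxCoeff k * (16 * h (k + 1) ^ 2))) := by
  have hev : ∀ᶠ z : ℝ in nhdsWithin 0 (Set.Ioi 0), 0 < z ∧ z ≤ 1 / 32 := by
    filter_upwards [Ioc_mem_nhdsGT (show (0 : ℝ) < 1 / 32 by norm_num)] with z hz using hz
  have h1 : Filter.Tendsto (fun z => ∑' k : ℕ, auxCoeff k *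
      ((pochRatio (k + 1) (1 / 2 - z) - 1) ^ 2 / pochRatio (k + 1) (1 / 2 - z) / z ^ 2))
      (nhdsWithin 0 (Set.Ioi 0)) (nhds (∑' k : ℕ, auxCoeff k * (16 * h (k + 1) ^ 2))) := by
    refine tendsto_tsum_of_dominated_convergence ((summable_exp_H.mul_left 5184).mul_left 32)
      (fun k => Filter.Tendsto.const_mul _ ?_) ?_
    · have h2 := (hasDerivAt_pochRatio_half (k + 1)).tendsto_slope_zero_right
      have h3 := (hasDerivAt_pochRatio_half (k + 1)).continuousAt.tendsto.mono_left
        (nhdsWithin_le_nhds (s := Set.Ioi 0))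
      simp only [sub_zero, pochRatio_half, zero_add] at h2 h3
      have h4 := (h2.pow 2).div h3 one_ne_zero
      rw [div_one, mul_pow] at h4
      norm_num at h4 ⊢
      refine h4.congr' ?_
      filter_upwards [hev] with z hz
      simp only [Pi.div_apply]
      rw [mul_pow, inv_pow]
      ring
    · filter_upwards [hev] with z hz k
      have h2 := one_le_pochRatio_half_sub hz.1.le hz.2 (k + 1)
      have h3 : 0 < z := hz.1
      rw [Real.norm_eq_abs, abs_of_nonneg (mul_nonneg (auxCoeff_nonneg k) (by positivity))]
      refine le_trans ?_ (mul_le_mul_of_nonneg_left (auxCoeff_mul_le k) (by norm_num))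
      rw [mul_left_comm]
      refine mul_le_mul_of_nonneg_left ?_ (auxCoeff_nonneg k)
      rw [div_le_iff₀ (by positivity), mul_comm _ (z ^ 2)]
      exact sub_one_sq_div_le hz.1.le hz.2 (k + 1)
  refine h1.congr' ?_
  filter_upwards [hev] with z hz
  have h2 := ((((hasSum_auxSeries (s := 1 / 2 + z) (by linarith)).add
    (hasSum_auxSeries (s := 1 / 2 - z) (by linarith))).sub
    ((hasSum_auxSeries (s := 1 / 2) (by norm_num)).mul_left 2)).div_const (z ^ 2))
  rw [← h2.tsum_eq]
  refine tsum_congr fun k => ?_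
  rw [← pochRatio_second_difference hz.1.le hz.2]
  ring

lemma inv_pow_three_second_difference {x z : ℝ} (hz : 0 < z) (hx : 16 * z ≤ x) :
    (1 / (x + z) ^ 3 + 1 / (x - z) ^ 3 - 2 * (1 / x ^ 3)) / z ^ 2
      = (12 * x ^ 4 - 6 * x ^ 2 * z ^ 2 + 2 * z ^ 4) / (x ^ 3 * (x ^ 2 - z ^ 2) ^ 3) := by
  have h1 : x + z ≠ 0 := by linarith
  have h2 : x - z ≠ 0 := by linarith
  have h3 : x ≠ 0 := by linarith
  rw [sq_sub_sq]
  field_simp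
  ring

lemma abs_div_le_of_le {x z : ℝ} (hz : 0 < z) (hx : 16 * z ≤ x) :
    ‖(12 * x ^ 4 - 6 * x ^ 2 * z ^ 2 + 2 * z ^ 4) / (x ^ 3 * (x ^ 2 - z ^ 2) ^ 3)‖
      ≤ 112 * (1 / x ^ 5) := by
  have hx0 : 0 < x := by linarith
  have h1 : x ^ 2 / 2 ≤ x ^ 2 - z ^ 2 := by nlinarith
  have h2 : z ^ 2 ≤ x ^ 2 := by nlinarith
  rw [norm_div, Real.norm_eq_abs, Real.norm_eq_abs, abs_of_pos (a := x ^ 3 * (x ^ 2 - z ^ 2) ^ 3)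
    (by have : 0 < x ^ 2 - z ^ 2 := by nlinarith [sq_nonneg x, pow_pos hx0 2]
        positivity)]
  calc _ ≤ 14 * x ^ 4 / (x ^ 3 * (x ^ 2 / 2) ^ 3) := by
        gcongr
        refine abs_le.2 ⟨?_, ?_⟩ <;> nlinarith [sq_nonneg (z ^ 2), sq_nonneg (x * z), sq_nonneg x]
    _ = _ := by field_simp; norm_num

lemma tendsto_inv_pow_three_second_difference :
    Filter.Tendsto (fun z => (auxSeries (1 / 2 + z) + auxSeries (1 / 2 - z)
      - 2 * auxSeries (1 / 2)) / z ^ 2) (nhdsWithin 0 (Set.Ioi 0))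
      (nhds (∑' i : ℕ, 12 * (1 / (1 / 2 + (i : ℝ)) ^ 5))) := by
  have hev : ∀ᶠ z : ℝ in nhdsWithin 0 (Set.Ioi 0), 0 < z ∧ z ≤ 1 / 32 := by
    filter_upwards [Ioc_mem_nhdsGT (show (0 : ℝ) < 1 / 32 by norm_num)] with z hz using hz
  have hs : Summable fun i : ℕ => 1 / (1 / 2 + (i : ℝ)) ^ 5 := by
    refine ((hasSum_oddZeta (s := 5) (by norm_num)).summable.mul_left 32).congr fun i => ?_
    have : (2 * (i : ℝ) + 1) ≠ 0 := by positivity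
    rw [show 1 / 2 + (i : ℝ) = (2 * i + 1) / 2 by ring, div_pow]
    field_simp
    norm_num
  have h1 : Filter.Tendsto (fun z => ∑' i : ℕ, (12 * (1 / 2 + (i : ℝ)) ^ 4
      - 6 * (1 / 2 + (i : ℝ)) ^ 2 * z ^ 2 + 2 * z ^ 4) / ((1 / 2 + (i : ℝ)) ^ 3 *
      ((1 / 2 + (i : ℝ)) ^ 2 - z ^ 2) ^ 3)) (nhdsWithin 0 (Set.Ioi 0))
      (nhds (∑' i : ℕ, 12 * (1 / (1 / 2 + (i : ℝ)) ^ 5))) := by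
    refine tendsto_tsum_of_dominated_convergence (hs.mul_left 112) (fun i => ?_) ?_
    · have hx : (0 : ℝ) < 1 / 2 + i := by positivity
      generalize (1 / 2 + (i : ℝ)) = x at *
      have h2 : ContinuousAt (fun z => (12 * x ^ 4 - 6 * x ^ 2 * z ^ 2 + 2 * z ^ 4) /
          (x ^ 3 * (x ^ 2 - z ^ 2) ^ 3)) 0 := by
        refine ContinuousAt.div (by fun_prop) (by fun_prop) ?_
        norm_num
        exact hx.ne'
      have h3 := h2.tendsto.mono_left (nhdsWithin_le_nhds (s := Set.Ioi 0))
      convert h3 using 2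
      norm_num
      field_simp
    · filter_upwards [hev] with z hz i
      have hi : (0 : ℝ) ≤ i := Nat.cast_nonneg i
      exact abs_div_le_of_le hz.1 (by linarith)
  refine h1.congr' ?_
  filter_upwards [hev] with z hz
  have h2 := ((((hasSum_inv_add_pow_three (s := 1 / 2 + z) (by linarith)).add
    (hasSum_inv_add_pow_three (s := 1 / 2 - z) (by linarith))).sub
    ((hasSum_inv_add_pow_three (s := 1 / 2) (by norm_num)).mul_left 2)).div_const (z ^ 2))
  have e : ∀ a b c d : ℝ, a - d + (b - d) - 2 * (c - d) = a + b - 2 * c := fun _ _ _ _ => by ring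
  rw [e] at h2
  rw [← h2.tsum_eq]
  refine tsum_congr fun i => ?_
  have hi : (0 : ℝ) ≤ i := Nat.cast_nonneg i
  rw [← inv_pow_three_second_difference hz.1 (by linarith)]
  rw [show 1 / 2 + z + (i : ℝ) = 1 / 2 + i + z by ring,
    show 1 / 2 - z + (i : ℝ) = 1 / 2 + i - z by ring]

lemma hasSum_two_mul_H_sub_mul_h_sq :
    HasSum (fun k : ℕ => (2 * H (k + 1) - 1 / ((k : ℝ) + 1)) * h (k + 1) ^ 2 / ((k : ℝ) + 1) ^ 2)
      (12 * oddZeta 5) := by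
  have h1 := tendsto_nhds_unique tendsto_auxSeries_second_difference
    tendsto_inv_pow_three_second_difference
  have hs : Summable fun k : ℕ => auxCoeff k * (16 * h (k + 1) ^ 2) := by
    refine Summable.of_nonneg_of_le (fun k => mul_nonneg (auxCoeff_nonneg k) (by positivity))
      (fun k => ?_) ((summable_exp_H.mul_left 5184).mul_left 16)
    rw [mul_left_comm]
    refine mul_le_mul_of_nonneg_left ((mul_le_mul_of_nonneg_left ?_
      (auxCoeff_nonneg k)).trans (auxCoeff_mul_le k)) (by norm_num)
    have h2 := h_le_H (k + 1)
    have h3 := h_nonneg (k + 1)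
    have h4 := H_nonneg (k + 1)
    calc h (k + 1) ^ 2 ≤ H (k + 1) ^ 2 := by gcongr
      _ ≤ _ := le_mul_of_one_le_right (by positivity) (Real.one_le_exp (by positivity))
  have h2 := hs.hasSum
  have h3 : HasSum (fun i : ℕ => 12 * (1 / (1 / 2 + (i : ℝ)) ^ 5)) (384 * oddZeta 5) := by
    refine hasSum_of_eq ((hasSum_oddZeta (s := 5) (by norm_num)).mul_left 384) (fun i => ?_) rfl
    have : (2 * (i : ℝ) + 1) ≠ 0 := by positivity
    rw [show 1 / 2 + (i : ℝ) = (2 * i + 1) / 2 by ring, div_pow]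
    field_simp
    norm_num
  rw [h1, h3.tsum_eq] at h2
  refine hasSum_of_eq (h2.div_const 32) (fun k => ?_) (by ring)
  rw [auxCoeff]
  ring

lemma integral_pow_mul_exp_neg {N : ℝ} (hN : 0 < N) (n : ℕ) :
    ∫ t in Set.Ioi (0 : ℝ), t ^ n * exp (-(N * t)) = n.factorial / N ^ (n + 1) := by
  have := Real.integral_rpow_mul_exp_neg_mul_Ioi (a := n + 1) (r := N) (by positivity) hN
  simp only [add_sub_cancel_right, Real.rpow_natCast] at this
  rw [this, Real.Gamma_nat_eq_factorial, ← Nat.cast_succ, Real.rpow_natCast, one_div, inv_pow,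
    Nat.succ_eq_add_one]
  exact inv_mul_eq_div _ _

lemma integrableOn_pow_mul_exp_neg {N : ℝ} (hN : 0 < N) (n : ℕ) :
    MeasureTheory.IntegrableOn (fun t => t ^ n * exp (-(N * t))) (Set.Ioi 0) := by
  by_contra hf
  have h1 := MeasureTheory.integral_undef hf
  rw [integral_pow_mul_exp_neg hN] at h1
  have : (0 : ℝ) < n.factorial / N ^ (n + 1) := by positivity
  exact this.ne' h1

lemma lintegral_pow_mul_exp_neg {N : ℝ} (hN : 0 < N) (n : ℕ) :
    ∫⁻ t in Set.Ioi (0 : ℝ), ENNReal.ofReal (t ^ n * exp (-(N * t)))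
      = ENNReal.ofReal (n.factorial / N ^ (n + 1)) := by
  rw [← integral_pow_mul_exp_neg hN, MeasureTheory.ofReal_integral_eq_lintegral_ofReal
    (integrableOn_pow_mul_exp_neg hN n)]
  filter_upwards [MeasureTheory.ae_restrict_mem measurableSet_Ioi] with t ht
  have : 0 < t := ht
  simp only [Pi.zero_apply]
  positivity

/-- The hyperbolic tangent of `t / 2`. -/
noncomputable def tanhHalf (t : ℝ) : ℝ := (1 - exp (-t)) / (1 + exp (-t))

lemma tanhHalf_zero : tanhHalf 0 = 0 := by simp [tanhHalf]

lemma tanhHalf_pos {t : ℝ} (ht : 0 < t) : 0 < tanhHalf t := by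
  have : exp (-t) < 1 := Real.exp_lt_one_iff.2 (by linarith)
  exact div_pos (by linarith) (by positivity)

lemma tanhHalf_lt_one (t : ℝ) : tanhHalf t < 1 := by
  have : 0 < exp (-t) := Real.exp_pos _
  rw [tanhHalf, div_lt_one (by positivity)]
  linarith

lemma one_sub_tanhHalf_le (t : ℝ) : 1 - tanhHalf t ≤ 2 * exp (-t) := by
  have : 0 < exp (-t) := Real.exp_pos _
  have e : 1 - tanhHalf t = 2 * exp (-t) / (1 + exp (-t)) := by
    rw [tanhHalf]; field_simp; ring
  rw [e]
  exact div_le_self (by positivity) (by linarith)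

lemma hasDerivAt_tanhHalf (t : ℝ) : HasDerivAt tanhHalf ((1 - tanhHalf t ^ 2) / 2) t := by
  have h1 : HasDerivAt (fun t => exp (-t)) (-exp (-t)) t := by
    simpa using (hasDerivAt_neg t).exp
  have h0 : 1 + exp (-t) ≠ 0 := by positivity
  refine ((h1.const_sub 1).div (h1.const_add 1) h0).congr_deriv ?_
  rw [tanhHalf]
  generalize exp (-t) = q at *
  field_simp
  ring

lemma continuous_tanhHalf : Continuous tanhHalf :=
  continuous_iff_continuousAt.2 fun t => (hasDerivAt_tanhHalf t).continuousAt

lemma tendsto_tanhHalf : Filter.Tendsto tanhHalf Filter.atTop (nhds 1) := by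
  have h1 : Filter.Tendsto (fun t => exp (-t)) Filter.atTop (nhds 0) :=
    Real.tendsto_exp_neg_atTop_nhds_zero
  have := (h1.const_sub 1).div (h1.const_add 1) (by norm_num)
  rw [sub_zero, add_zero, div_one] at this
  exact this

lemma tendsto_mul_one_sub_tanhHalf_pow (n : ℕ) :
    Filter.Tendsto (fun t => t * (1 - tanhHalf t ^ n)) Filter.atTop (nhds 0) := by
  have h1 := (Real.tendsto_pow_mul_exp_neg_atTop_nhds_zero 1).const_mul (2 * n : ℝ)
  rw [mul_zero] at h1
  refine squeeze_zero' ?_ ?_ h1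
  · filter_upwards [Filter.eventually_gt_atTop 0] with t ht
    exact mul_nonneg ht.le (sub_nonneg.2 (pow_le_one₀ (tanhHalf_pos ht).le (tanhHalf_lt_one t).le))
  · filter_upwards [Filter.eventually_gt_atTop 0] with t ht
    have h2 := one_add_mul_le_pow (a := tanhHalf t - 1) (by linarith [tanhHalf_pos ht]) n
    rw [add_sub_cancel] at h2
    have h3 := one_sub_tanhHalf_le t
    have h4 : (n : ℝ) * (1 - tanhHalf t) ≤ n * (2 * exp (-t)) := by gcongr
    calc t * (1 - tanhHalf t ^ n) ≤ t * (n * (2 * exp (-t))) := by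
          gcongr; linarith
      _ = _ := by ring

lemma lintegral_mul_tanhHalf_pow (k : ℕ) :
    ∫⁻ t in Set.Ioi (0 : ℝ), ENNReal.ofReal
      (t * tanhHalf t ^ (2 * k + 1) * ((1 - tanhHalf t ^ 2) / 2))
      = ENNReal.ofReal (h (k + 1) / ((k : ℝ) + 1)) := by
  have hk : (k : ℝ) + 1 ≠ 0 := by positivity
  have hderiv : ∀ t ∈ Set.Ici (0 : ℝ), HasDerivAt (fun t =>
      (∑ j ∈ Finset.range (k + 1), tanhHalf t ^ (2 * j + 1) * (1 / (2 * (j : ℝ) + 1))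
        - t * (1 - tanhHalf t ^ (2 * k + 2)) / 2) / ((k : ℝ) + 1))
      (t * tanhHalf t ^ (2 * k + 1) * ((1 - tanhHalf t ^ 2) / 2)) t := by
    intro t _
    have hx := hasDerivAt_tanhHalf t
    have h1 := HasDerivAt.fun_sum (u := Finset.range (k + 1)) fun j _ =>
      (hx.pow (2 * j + 1)).mul_const (1 / (2 * (j : ℝ) + 1))
    have h3 := (h1.sub (((hasDerivAt_id t).mul ((hx.pow (2 * k + 2)).const_sub 1)).div_const
      2)).div_const ((k : ℝ) + 1)
    refine h3.congr_deriv ?_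
    have e : ∑ j ∈ Finset.range (k + 1), ((2 * j + 1 : ℕ) : ℝ) * tanhHalf t ^ (2 * j + 1 - 1)
        * ((1 - tanhHalf t ^ 2) / 2) * (1 / (2 * (j : ℝ) + 1))
        = (1 - tanhHalf t ^ (2 * k + 2)) / 2 := by
      have h4 := mul_neg_geom_sum (tanhHalf t ^ 2) (k + 1)
      rw [← pow_mul] at h4
      rw [show 2 * k + 2 = 2 * (k + 1) by ring, ← h4, Finset.mul_sum, Finset.sum_div]
      refine Finset.sum_congr rfl fun j _ => ?_
      have : 2 * (j : ℝ) + 1 ≠ 0 := by positivity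
      rw [← pow_mul, Nat.add_sub_cancel]
      push_cast
      field_simp
    rw [e]
    simp only [id, Pi.pow_apply, one_mul, show 2 * k + 2 - 1 = 2 * k + 1 by omega]
    push_cast
    field_simp
    ring
  have hnn : ∀ t ∈ Set.Ioi (0 : ℝ),
      0 ≤ t * tanhHalf t ^ (2 * k + 1) * ((1 - tanhHalf t ^ 2) / 2) := by
    intro t ht
    have h1 := tanhHalf_pos ht
    have h2 := tanhHalf_lt_one t
    have h3 : 0 ≤ 1 - tanhHalf t ^ 2 := by nlinarith
    have : 0 < t := ht
    positivity
  have hlim : Filter.Tendsto (fun t =>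
      (∑ j ∈ Finset.range (k + 1), tanhHalf t ^ (2 * j + 1) * (1 / (2 * (j : ℝ) + 1))
        - t * (1 - tanhHalf t ^ (2 * k + 2)) / 2) / ((k : ℝ) + 1)) Filter.atTop
      (nhds (h (k + 1) / ((k : ℝ) + 1))) := by
    have h1 : Filter.Tendsto (fun t => ∑ j ∈ Finset.range (k + 1),
        tanhHalf t ^ (2 * j + 1) * (1 / (2 * (j : ℝ) + 1))) Filter.atTop (nhds (h (k + 1))) := by
      have := tendsto_finsetSum (Finset.range (k + 1)) fun j _ =>
        (tendsto_tanhHalf.pow (2 * j + 1)).mul_const (1 / (2 * (j : ℝ) + 1))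
      simpa [h] using this
    have h2 := (h1.sub ((tendsto_mul_one_sub_tanhHalf_pow (2 * k + 2)).div_const 2)).div_const
      ((k : ℝ) + 1)
    simpa using h2
  have h1 := MeasureTheory.integral_Ioi_of_hasDerivAt_of_nonneg' hderiv hnn hlim
  have h2 := MeasureTheory.integrableOn_Ioi_deriv_of_nonneg' hderiv hnn hlim
  rw [← MeasureTheory.ofReal_integral_eq_lintegral_ofReal h2
    ((MeasureTheory.ae_restrict_mem measurableSet_Ioi).mono hnn), h1]
  simp [tanhHalf_zero]

lemma hasSum_tanhHalf_pow {t : ℝ} (ht : 0 < t) :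
    HasSum (fun k : ℕ => h (k + 1) / ((k : ℝ) + 1) * tanhHalf t ^ (2 * k + 2)) (t ^ 2 / 4) := by
  have h0 := tanhHalf_pos ht
  have h1 := Real.hasSum_log_sub_log_of_abs_lt_one
    (x := tanhHalf t) (by rw [abs_of_pos h0]; exact tanhHalf_lt_one t)
  have e : log (1 + tanhHalf t) - log (1 - tanhHalf t) = t := by
    have hq : 0 < exp (-t) := Real.exp_pos _
    have h2 : 0 < 1 - tanhHalf t := sub_pos.2 (tanhHalf_lt_one t)
    rw [← Real.log_div (by positivity) h2.ne']
    have : (1 + tanhHalf t) / (1 - tanhHalf t) = exp t := by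
      rw [div_eq_iff h2.ne', tanhHalf, ← neg_neg t, Real.exp_neg (-t), neg_neg]
      field_simp
      ring
    rw [this, Real.log_exp]
  rw [e] at h1
  have h2 := h1.div_const 2
  have h3 : Summable fun m : ℕ => ‖2 * (1 / (2 * (m : ℝ) + 1)) * tanhHalf t ^ (2 * m + 1) / 2‖ :=
    h2.summable.norm
  have h4 := hasSum_sum_range_mul_of_summable_norm h3 h3
  rw [h2.tsum_eq] at h4
  refine hasSum_of_eq h4 (fun k => ?_) (by ring)
  have hk : (k : ℝ) + 1 ≠ 0 := by positivity
  have e1 : ∀ j ∈ Finset.range (k + 1), 2 * (1 / (2 * (j : ℝ) + 1)) * tanhHalf t ^ (2 * j + 1) / 2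
      * (2 * (1 / (2 * ((k - j : ℕ) : ℝ) + 1)) * tanhHalf t ^ (2 * (k - j) + 1) / 2)
      = (1 / (2 * (j : ℝ) + 1) + 1 / (2 * ((k - j : ℕ) : ℝ) + 1))
        * (tanhHalf t ^ (2 * k + 2) / (2 * ((k : ℝ) + 1))) := by
    intro j hj
    have hjk : j ≤ k := Nat.lt_succ_iff.1 (Finset.mem_range.1 hj)
    have e2 : tanhHalf t ^ (2 * k + 2) = tanhHalf t ^ (2 * j + 1) * tanhHalf t ^ (2 * (k - j) + 1) := by
      rw [← pow_add]; congr 1; omega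
    have e3 : 2 * ((k : ℝ) + 1) = (2 * (j : ℝ) + 1) + (2 * ((k - j : ℕ) : ℝ) + 1) := by
      rw [Nat.cast_sub hjk]; ring
    rw [e2, e3]
    have p1 : 0 < 2 * (j : ℝ) + 1 := by positivity
    have p2 : 0 < 2 * ((k - j : ℕ) : ℝ) + 1 := by positivity
    generalize 2 * (j : ℝ) + 1 = a at *
    generalize 2 * ((k - j : ℕ) : ℝ) + 1 = b at *
    field_simp
    ring
  rw [Finset.sum_congr rfl e1, ← Finset.sum_mul, Finset.sum_add_distrib, ← h]
  have e2 : ∑ j ∈ Finset.range (k + 1), 1 / (2 * ((k - j : ℕ) : ℝ) + 1) = h (k + 1) := by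
    have := Finset.sum_range_reflect (fun j : ℕ => 1 / (2 * (j : ℝ) + 1)) (k + 1)
    simpa [h] using this
  rw [e2]
  field_simp
  ring

lemma hasSum_two_mul_exp_neg {t : ℝ} (ht : 0 < t) :
    HasSum (fun c : ℕ => 2 * exp (-((2 * (c : ℝ) + 1) * t)))
      ((1 - tanhHalf t ^ 2) / 2 / tanhHalf t) := by
  have hq : exp (-t) < 1 := Real.exp_lt_one_iff.2 (by linarith)
  have hq0 : 0 < exp (-t) := Real.exp_pos _
  have h1 := (hasSum_geometric_of_lt_one (r := exp (-t) ^ 2) (by positivity)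
    (by nlinarith)).mul_left (2 * exp (-t))
  refine hasSum_of_eq h1 (fun c => ?_) ?_
  · rw [← pow_mul, ← Real.exp_nat_mul, mul_assoc, ← Real.exp_add]
    push_cast
    ring_nf
  · rw [tanhHalf]
    generalize exp (-t) = q at *
    have p1 : 1 - q ≠ 0 := by linarith
    have p2 : 1 + q ≠ 0 := by linarith
    have p3 : 1 - q ^ 2 ≠ 0 := by nlinarith
    rw [show 1 - q ^ 2 = (1 - q) * (1 + q) by ring]
    field_simp
    ring

lemma ofReal_eq_tsum_of_hasSum {f : ℕ → ℝ} {a : ℝ} (hf : ∀ n, 0 ≤ f n) (hs : HasSum f a) :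
    ENNReal.ofReal a = ∑' n, ENNReal.ofReal (f n) := by
  rw [← ENNReal.ofReal_tsum_of_nonneg hf hs.summable, hs.tsum_eq]

lemma hasSum_of_tsum_ofReal_eq {f : ℕ → ℝ} {a : ℝ} (hf : ∀ n, 0 ≤ f n) (ha : 0 ≤ a)
    (hs : ∑' n, ENNReal.ofReal (f n) = ENNReal.ofReal a) : HasSum f a := by
  have h1 := ENNReal.hasSum_toReal (f := fun n => ENNReal.ofReal (f n))
    (by rw [hs]; exact ENNReal.ofReal_ne_top)
  rw [← ENNReal.tsum_toReal_eq fun _ => ENNReal.ofReal_ne_top, hs, ENNReal.toReal_ofReal ha] at h1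
  exact hasSum_of_eq h1 (fun n => (ENNReal.toReal_ofReal (hf n)).symm) rfl

lemma tsum_tsum_eq_tsum_sum_antidiagonal (f : ℕ → ℕ → ENNReal) :
    ∑' i, ∑' j, f i j = ∑' n, ∑ p ∈ Finset.HasAntidiagonal.antidiagonal n, f p.1 p.2 := by
  rw [← ENNReal.tsum_prod, ← Finset.HasAntidiagonal.sigmaAntidiagonalEquivProd.tsum_eq,
    ENNReal.tsum_sigma']
  refine tsum_congr fun n => ?_
  rw [tsum_fintype]
  exact Finset.sum_coe_sort (Finset.HasAntidiagonal.antidiagonal n) fun p => f p.1 p.2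

lemma tanhHalf_mem {t : ℝ} (ht : 0 < t) :
    0 < tanhHalf t ∧ tanhHalf t < 1 ∧ 0 ≤ (1 - tanhHalf t ^ 2) / 2 := by
  have h1 := tanhHalf_pos ht
  have h2 := tanhHalf_lt_one t
  refine ⟨h1, h2, ?_⟩
  nlinarith

lemma lintegral_mul_exp_neg_mul_tanhHalf_pow {b : ℝ} (hb : 0 < b) (k : ℕ) :
    ∫⁻ t in Set.Ioi (0 : ℝ), ENNReal.ofReal (t * exp (-(b * t)) * tanhHalf t ^ (2 * k + 2))
      = ∫⁻ t in Set.Ioi (0 : ℝ), ENNReal.ofReal ((2 * (k : ℝ) + 2) * (exp (-(b * t))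
        * (t / b + 1 / b ^ 2) * (tanhHalf t ^ (2 * k + 1) * ((1 - tanhHalf t ^ 2) / 2)))) := by
  have hx := continuous_tanhHalf
  have i0 := integrableOn_pow_mul_exp_neg hb 0
  have i1 := integrableOn_pow_mul_exp_neg hb 1
  simp only [pow_zero, one_mul, pow_one] at i0 i1
  have hf : MeasureTheory.IntegrableOn
      (fun t => t * exp (-(b * t)) * tanhHalf t ^ (2 * k + 2)) (Set.Ioi 0) := by
    refine MeasureTheory.Integrable.mono' i1 (by fun_prop) ?_
    filter_upwards [MeasureTheory.ae_restrict_mem measurableSet_Ioi] with t ht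
    obtain ⟨h1, h2, h3⟩ := tanhHalf_mem ht
    have : 0 < t := ht
    rw [Real.norm_of_nonneg (by positivity)]
    exact mul_le_of_le_one_right (by positivity) (pow_le_one₀ h1.le h2.le)
  have hg : MeasureTheory.IntegrableOn (fun t => (2 * (k : ℝ) + 2) * (exp (-(b * t))
      * (t / b + 1 / b ^ 2) * (tanhHalf t ^ (2 * k + 1) * ((1 - tanhHalf t ^ 2) / 2))))
      (Set.Ioi 0) := by
    refine MeasureTheory.Integrable.const_mul ?_ _
    refine MeasureTheory.Integrable.mono' ((i1.div_const b).add (i0.div_const (b ^ 2)))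
      (by fun_prop) ?_
    filter_upwards [MeasureTheory.ae_restrict_mem measurableSet_Ioi] with t ht
    obtain ⟨h1, h2, h3⟩ := tanhHalf_mem ht
    have : 0 < t := ht
    rw [Real.norm_of_nonneg (by positivity)]
    calc _ ≤ exp (-(b * t)) * (t / b + 1 / b ^ 2) :=
          mul_le_of_le_one_right (by positivity)
            (mul_le_one₀ (pow_le_one₀ h1.le h2.le) h3 (by nlinarith))
      _ = _ := by
          simp only [Pi.add_apply]; ring
  have hderiv : ∀ t ∈ Set.Ici (0 : ℝ), HasDerivAt
      (fun t => (t * exp (-(b * t)) / b + exp (-(b * t)) / b ^ 2) * tanhHalf t ^ (2 * k + 2))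
      ((2 * (k : ℝ) + 2) * (exp (-(b * t)) * (t / b + 1 / b ^ 2)
        * (tanhHalf t ^ (2 * k + 1) * ((1 - tanhHalf t ^ 2) / 2)))
        - t * exp (-(b * t)) * tanhHalf t ^ (2 * k + 2)) t := by
    intro t _
    have he : HasDerivAt (fun t => exp (-(b * t))) (-b * exp (-(b * t))) t := by
      have := (((hasDerivAt_id t).const_mul b).neg).exp
      simpa [mul_comm] using this
    refine (((((hasDerivAt_id t).mul he).div_const b).add (he.div_const (b ^ 2))).mul
      ((hasDerivAt_tanhHalf t).pow (2 * k + 2))).congr_deriv ?_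
    simp only [id, Pi.pow_apply, Pi.mul_apply, Pi.add_apply,
      show 2 * k + 2 - 1 = 2 * k + 1 by omega]
    push_cast
    field_simp
    ring
  have hlim : Filter.Tendsto
      (fun t => (t * exp (-(b * t)) / b + exp (-(b * t)) / b ^ 2) * tanhHalf t ^ (2 * k + 2))
      Filter.atTop (nhds 0) := by
    have hbt : Filter.Tendsto (fun t => b * t) Filter.atTop Filter.atTop :=
      Filter.tendsto_id.const_mul_atTop hb
    have h0 := (Real.tendsto_pow_mul_exp_neg_atTop_nhds_zero 0).comp hbt
    have h1 := (Real.tendsto_pow_mul_exp_neg_atTop_nhds_zero 1).comp hbt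
    have h2 := ((h1.div_const (b ^ 2)).add (h0.div_const (b ^ 2))).mul
      (tendsto_tanhHalf.pow (2 * k + 2))
    rw [zero_div, zero_add, zero_mul] at h2
    refine h2.congr fun t => ?_
    simp only [Function.comp_apply]
    field_simp
  have h1 := MeasureTheory.integral_Ioi_of_hasDerivAt_of_tendsto' hderiv (hg.sub hf) hlim
  rw [MeasureTheory.integral_sub hg hf] at h1
  simp only [tanhHalf_zero, ne_eq, Nat.add_eq_zero_iff, OfNat.ofNat_ne_zero, and_false,
    not_false_eq_true, zero_pow, mul_zero, sub_zero] at h1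
  rw [← MeasureTheory.ofReal_integral_eq_lintegral_ofReal hf,
    ← MeasureTheory.ofReal_integral_eq_lintegral_ofReal hg, sub_eq_zero.1 h1]
  all_goals
    filter_upwards [MeasureTheory.ae_restrict_mem measurableSet_Ioi] with t ht
    obtain ⟨h1, h2, h3⟩ := tanhHalf_mem ht
    have : 0 < t := ht
    simp only [Pi.zero_apply]
    positivity

lemma ofReal_h_sq_div_pow_three (k : ℕ) :
    ENNReal.ofReal (h (k + 1) ^ 2 / ((k : ℝ) + 1) ^ 3) = ∑' m : ℕ, ∫⁻ t in Set.Ioi (0 : ℝ),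
      ENNReal.ofReal (4 * (h (k + 1) / ((k : ℝ) + 1)) * (exp (-((2 * (m : ℝ) + 1) * t))
        * (t / (2 * (m : ℝ) + 1) + 1 / (2 * (m : ℝ) + 1) ^ 2)
        * (tanhHalf t ^ (2 * k + 1) * ((1 - tanhHalf t ^ 2) / 2)))) := by
  have hx := continuous_tanhHalf
  have hh := h_nonneg (k + 1)
  have hk : (0 : ℝ) < (k : ℝ) + 1 := by positivity
  set c := h (k + 1) / ((k : ℝ) + 1) ^ 2 with hc
  have hc0 : 0 ≤ c := by positivity
  have h1 : ∀ t ∈ Set.Ioi (0 : ℝ), ENNReal.ofReal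
      (t * tanhHalf t ^ (2 * k + 1) * ((1 - tanhHalf t ^ 2) / 2)) = ∑' m : ℕ, ENNReal.ofReal 2 *
      ENNReal.ofReal (t * exp (-((2 * (m : ℝ) + 1) * t)) * tanhHalf t ^ (2 * k + 2)) := by
    intro t ht
    have ht0 : 0 < t := ht
    obtain ⟨h1, h2, h3⟩ := tanhHalf_mem ht
    have h4 := (hasSum_two_mul_exp_neg ht).mul_left (t * tanhHalf t ^ (2 * k + 2))
    have e : t * tanhHalf t ^ (2 * k + 2) * ((1 - tanhHalf t ^ 2) / 2 / tanhHalf t)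
        = t * tanhHalf t ^ (2 * k + 1) * ((1 - tanhHalf t ^ 2) / 2) := by
      rw [pow_succ _ (2 * k + 1)]
      field_simp
    rw [e] at h4
    rw [ofReal_eq_tsum_of_hasSum (fun n => by positivity) h4]
    refine tsum_congr fun m => ?_
    rw [← ENNReal.ofReal_mul two_pos.le]
    congr 1
    ring
  calc ENNReal.ofReal (h (k + 1) ^ 2 / ((k : ℝ) + 1) ^ 3)
      = ENNReal.ofReal c * ENNReal.ofReal (h (k + 1) / ((k : ℝ) + 1)) := by
        rw [← ENNReal.ofReal_mul hc0, hc]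
        congr 1
        field_simp
    _ = ∑' m : ℕ, ENNReal.ofReal c * (ENNReal.ofReal 2 * ∫⁻ t in Set.Ioi (0 : ℝ),
          ENNReal.ofReal (t * exp (-((2 * (m : ℝ) + 1) * t)) * tanhHalf t ^ (2 * k + 2))) := by
        rw [← lintegral_mul_tanhHalf_pow, MeasureTheory.setLIntegral_congr_fun measurableSet_Ioi h1,
          MeasureTheory.lintegral_tsum (fun m => by fun_prop), ENNReal.tsum_mul_left]
        congr 1
        exact tsum_congr fun m => MeasureTheory.lintegral_const_mul _ (by fun_prop)
    _ = _ := by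
        refine tsum_congr fun m => ?_
        rw [lintegral_mul_exp_neg_mul_tanhHalf_pow (by positivity), ← mul_assoc,
          ← ENNReal.ofReal_mul hc0, ← MeasureTheory.lintegral_const_mul _ (by fun_prop)]
        refine MeasureTheory.lintegral_congr fun t => ?_
        rw [← ENNReal.ofReal_mul (by positivity), hc]
        congr 1
        field_simp
        ring

lemma tsum_lintegral_eq (m : ℕ) :
    ∑' k : ℕ, ∫⁻ t in Set.Ioi (0 : ℝ), ENNReal.ofReal (4 * (h (k + 1) / ((k : ℝ) + 1))
      * (exp (-((2 * (m : ℝ) + 1) * t)) * (t / (2 * (m : ℝ) + 1) + 1 / (2 * (m : ℝ) + 1) ^ 2)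
        * (tanhHalf t ^ (2 * k + 1) * ((1 - tanhHalf t ^ 2) / 2))))
      = ∑' c : ℕ, ENNReal.ofReal (12 / ((2 * (m : ℝ) + 1) * (2 * ((m : ℝ) + c + 1)) ^ 4)
        + 4 / ((2 * (m : ℝ) + 1) ^ 2 * (2 * ((m : ℝ) + c + 1)) ^ 3)) := by
  have hx := continuous_tanhHalf
  rw [← MeasureTheory.lintegral_tsum (fun k => by fun_prop)]
  have hm : 0 < 2 * (m : ℝ) + 1 := by positivity
  have e1 : ∀ c : ℕ, 2 * ((m : ℝ) + c + 1) = 2 * m + 1 + (2 * c + 1) := fun c => by ring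
  simp only [e1]
  generalize 2 * (m : ℝ) + 1 = b at *
  have h1 : ∀ t ∈ Set.Ioi (0 : ℝ), ∑' k : ℕ, ENNReal.ofReal (4 * (h (k + 1) / ((k : ℝ) + 1))
      * (exp (-(b * t)) * (t / b + 1 / b ^ 2)
        * (tanhHalf t ^ (2 * k + 1) * ((1 - tanhHalf t ^ 2) / 2))))
      = ∑' c : ℕ, (ENNReal.ofReal (2 / b) * ENNReal.ofReal (t ^ 3 * exp (-((b + (2 * c + 1)) * t)))
        + ENNReal.ofReal (2 / b ^ 2) * ENNReal.ofReal (t ^ 2 * exp (-((b + (2 * c + 1)) * t)))) := by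
    intro t ht
    have ht0 : 0 < t := ht
    obtain ⟨h1, h2, h3⟩ := tanhHalf_mem ht
    have h4 := (hasSum_tanhHalf_pow ht).mul_left (4 * (exp (-(b * t)) * (t / b + 1 / b ^ 2)) *
      ((1 - tanhHalf t ^ 2) / 2 / tanhHalf t))
    have h5 := (hasSum_two_mul_exp_neg ht).mul_left
      (t ^ 2 * (exp (-(b * t)) * (t / b + 1 / b ^ 2)))
    have h6 := ofReal_eq_tsum_of_hasSum (fun n => by
      have := h_nonneg (n + 1)
      positivity) h4
    have h7 := ofReal_eq_tsum_of_hasSum (fun n => by positivity) h5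
    have e : 4 * (exp (-(b * t)) * (t / b + 1 / b ^ 2)) * ((1 - tanhHalf t ^ 2) / 2 / tanhHalf t)
        * (t ^ 2 / 4) = t ^ 2 * (exp (-(b * t)) * (t / b + 1 / b ^ 2))
        * ((1 - tanhHalf t ^ 2) / 2 / tanhHalf t) := by ring
    rw [← e, h6] at h7
    refine Eq.trans (tsum_congr fun k => ?_) (h7.trans (tsum_congr fun c => ?_))
    · congr 1
      rw [pow_succ _ (2 * k + 1)]
      field_simp
    · rw [← ENNReal.ofReal_mul (by positivity), ← ENNReal.ofReal_mul (by positivity),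
        ← ENNReal.ofReal_add (by positivity) (by positivity),
        show -((b + (2 * (c : ℝ) + 1)) * t) = -(b * t) + -((2 * c + 1) * t) by ring, Real.exp_add]
      congr 1
      field_simp
  rw [MeasureTheory.setLIntegral_congr_fun measurableSet_Ioi h1,
    MeasureTheory.lintegral_tsum (fun c => by fun_prop)]
  refine tsum_congr fun c => ?_
  have hN : 0 < b + (2 * (c : ℝ) + 1) := by positivity
  rw [MeasureTheory.lintegral_add_left (by fun_prop), MeasureTheory.lintegral_const_mul _
    (by fun_prop), MeasureTheory.lintegral_const_mul _ (by fun_prop),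
    lintegral_pow_mul_exp_neg hN, lintegral_pow_mul_exp_neg hN,
    ← ENNReal.ofReal_mul (by positivity), ← ENNReal.ofReal_mul (by positivity),
    ← ENNReal.ofReal_add (by positivity) (by positivity)]
  congr 1
  norm_num [Nat.factorial]
  field_simp
  ring

lemma hasSum_h_sq_div_pow_three {S : ℝ} (hS : HasSum (fun k : ℕ =>
      12 * (h (k + 1) / (2 * ((k : ℝ) + 1)) ^ 4) + 4 * (h2 (k + 1) / (2 * ((k : ℝ) + 1)) ^ 3)) S) :
    HasSum (fun k : ℕ => h (k + 1) ^ 2 / ((k : ℝ) + 1) ^ 3) S := by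
  have h2_nonneg : ∀ k, 0 ≤ h2 k := fun k => Finset.sum_nonneg fun _ _ => by positivity
  have hn : ∀ k : ℕ, 0 ≤ 12 * (h (k + 1) / (2 * ((k : ℝ) + 1)) ^ 4)
      + 4 * (h2 (k + 1) / (2 * ((k : ℝ) + 1)) ^ 3) := fun k => by
    have := h_nonneg (k + 1)
    have := h2_nonneg (k + 1)
    positivity
  refine hasSum_of_tsum_ofReal_eq (fun k => by positivity) (hS.nonneg hn) ?_
  simp only [ofReal_h_sq_div_pow_three]
  rw [ENNReal.tsum_comm]
  simp only [tsum_lintegral_eq]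
  rw [tsum_tsum_eq_tsum_sum_antidiagonal, ofReal_eq_tsum_of_hasSum hn hS]
  refine tsum_congr fun n => ?_
  rw [← ENNReal.ofReal_sum_of_nonneg (fun p _ => by positivity)]
  congr 1
  rw [Finset.Nat.sum_antidiagonal_eq_sum_range_succ_mk, h, h2, Finset.sum_div, Finset.sum_div,
    Finset.mul_sum, Finset.mul_sum, ← Finset.sum_add_distrib]
  refine Finset.sum_congr rfl fun j hj => ?_
  have hj' : j ≤ n := Nat.lt_succ_iff.1 (Finset.mem_range.1 hj)
  simp only [Nat.cast_sub hj', add_sub_cancel]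
  field_simp

theorem stmt5 :
    HasSum (fun k : ℕ => H (k + 1) * (h (k + 1)) ^ 2 / ((k : ℝ) + 1) ^ 2)
      ((155 / 32) * zeta 5 + (7 / 8) * zeta 2 * zeta 3) := by
  have hX := hasSum_h_sq_div_pow_three
    ((hasSum_h_div_pow_four.mul_left 12).add (hasSum_h2_div_pow_three.mul_left 4))
  refine hasSum_of_eq ((hasSum_two_mul_H_sub_mul_h_sq.add hX).div_const 2) (fun k => ?_) ?_
  · have : (k : ℝ) + 1 ≠ 0 := by positivity
    field_simp
    ring
  · rw [oddZeta_eq (by norm_num), oddZeta_eq (by norm_num), oddZeta_eq (by norm_num)]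
    ring
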